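/- Let f = xyz + xyw + xzw + yzw ∈ ℂ[x,y,z,w]. The Hilbert function of the Milnor algebra M(f) = S/(f_x, f_y, f_z, f_w) satisfies: dim M(f)₀ = 1, dim M(f)₁ = 4, dim M(f)₂ = 6, dim M(f)₃ = 4, and dim M(f)_k = 4 for all k ≥ 4. -/

import Mathlib

open MvPolynomial Module

variable (n : ℕ)

/-- The subspace of tuples all of whose components are homogeneous of degree `m`. -/
noncomputable def degTuples (m : ℕ) :
    Submodule ℂ (Fin (n + 1) → MvPolynomial (Fin (n + 1)) ℂ) :=
  ⨅ i, (homogeneousSubmodule (Fin (n + 1)) ℂ m).comap (LinearMap.proj i)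

/-- The `ℂ`-linear map `(a₀,…,aₙ) ↦ ∑ᵢ aᵢ · f_{xᵢ}`. -/
noncomputable def relMap (f : MvPolynomial (Fin (n + 1)) ℂ) :
    (Fin (n + 1) → MvPolynomial (Fin (n + 1)) ℂ) →ₗ[ℂ] MvPolynomial (Fin (n + 1)) ℂ :=
  ∑ i : Fin (n + 1), (LinearMap.mulRight ℂ (pderiv i f)).comp (LinearMap.proj i)

/-- `AR(f)_m`: degree-`m` relations among the partial derivatives of `f`. -/
noncomputable def ARm (f : MvPolynomial (Fin (n + 1)) ℂ) (m : ℕ) :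
    Submodule ℂ (Fin (n + 1) → MvPolynomial (Fin (n + 1)) ℂ) :=
  degTuples n m ⊓ LinearMap.ker (relMap n f)

/-- The Koszul tuple with `f_{xⱼ}` in position `i` and `−f_{xᵢ}` in position `j`. -/
noncomputable def kosTuple (f : MvPolynomial (Fin (n + 1)) ℂ) (i j : Fin (n + 1)) :
    Fin (n + 1) → MvPolynomial (Fin (n + 1)) ℂ :=
  fun k => if k = i then pderiv j f else if k = j then -(pderiv i f) else 0

/-- `KR(f)`: the `S`-submodule generated by the Koszul relations. -/
noncomputable def KRsub (f : MvPolynomial (Fin (n + 1)) ℂ) :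
    Submodule (MvPolynomial (Fin (n + 1)) ℂ) (Fin (n + 1) → MvPolynomial (Fin (n + 1)) ℂ) :=
  Submodule.span _ {v | ∃ i j, i ≠ j ∧ v = kosTuple n f i j}

/-- `KR(f)_m`: the degree-`m` part of the Koszul relations. -/
noncomputable def KRm (f : MvPolynomial (Fin (n + 1)) ℂ) (m : ℕ) :
    Submodule ℂ (Fin (n + 1) → MvPolynomial (Fin (n + 1)) ℂ) :=
  degTuples n m ⊓ (KRsub n f).restrictScalars ℂ

/-- `dim ER(f)_m = dim (AR(f)_m / KR(f)_m)`. -/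
noncomputable def erDim (f : MvPolynomial (Fin (n + 1)) ℂ) (m : ℕ) : ℕ :=
  finrank ℂ (ARm n f m ⧸ (KRm n f m).comap (ARm n f m).subtype)

/-- The Jacobian ideal of `f`. -/
noncomputable def jacIdeal (f : MvPolynomial (Fin (n + 1)) ℂ) :
    Ideal (MvPolynomial (Fin (n + 1)) ℂ) :=
  Ideal.span (Set.range fun i => pderiv i f)

/-- `dim M(f)_k`: the dimension of the degree-`k` part of the Milnor algebra `S/J_f`. -/
noncomputable def milnorDim (f : MvPolynomial (Fin (n + 1)) ℂ) (k : ℕ) : ℕ :=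
  finrank ℂ ((homogeneousSubmodule (Fin (n + 1)) ℂ k).map
    (Ideal.Quotient.mkₐ ℂ (jacIdeal n f)).toLinearMap)

theorem finrank_map_eq_of_ker_iff {K V W U : Type*} [Field K] [AddCommGroup V] [Module K V]
    [AddCommGroup W] [Module K W] [AddCommGroup U] [Module K U] (P : Submodule K V)
    (q : V →ₗ[K] W) (L : V →ₗ[K] U) (hker : ∀ p ∈ P, q p = 0 ↔ L p = 0)
    (hsurj : ∀ u, ∃ p ∈ P, L p = u) : finrank K (P.map q) = finrank K U := by
  have hk : LinearMap.ker (q.domRestrict P) = LinearMap.ker (L.domRestrict P) := by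
    ext ⟨p, hp⟩
    simpa using hker p hp
  have hr : LinearMap.range (L.domRestrict P) = ⊤ := by
    refine LinearMap.range_eq_top.2 fun u => ?_
    obtain ⟨p, hp, rfl⟩ := hsurj u
    exact ⟨⟨p, hp⟩, rfl⟩
  rw [← LinearMap.range_domRestrict, ← (q.domRestrict P).quotKerEquivRange.finrank_eq, hk,
    (L.domRestrict P).quotKerEquivRange.finrank_eq, hr, finrank_top]

/-- To compute `milnorDim`, exhibit linear functionals cutting out the degree `k` part of the
Jacobian ideal inside the homogeneous polynomials of degree `k`. -/
theorem milnorDim_eq_finrank {n : ℕ} {f : MvPolynomial (Fin (n + 1)) ℂ} {k : ℕ} {U : Type*}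
    [AddCommGroup U] [Module ℂ U] (L : MvPolynomial (Fin (n + 1)) ℂ →ₗ[ℂ] U)
    (hker : ∀ p, p.IsHomogeneous k → (p ∈ jacIdeal n f ↔ L p = 0))
    (hsurj : ∀ u, ∃ p : MvPolynomial (Fin (n + 1)) ℂ, p.IsHomogeneous k ∧ L p = u) :
    milnorDim n f k = finrank ℂ U := by
  refine finrank_map_eq_of_ker_iff _ _ L (fun p hp => ?_) hsurj
  rw [← hker p hp]
  exact Ideal.Quotient.eq_zero_iff_mem

/-- A linear map kills the Jacobian ideal once it kills the multiples of the partials. -/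
theorem map_eq_zero_of_mem_jacIdeal {n : ℕ} {f : MvPolynomial (Fin (n + 1)) ℂ} {U : Type*}
    [AddCommGroup U] [Module ℂ U] (L : MvPolynomial (Fin (n + 1)) ℂ →ₗ[ℂ] U)
    (h : ∀ a i, L (a * pderiv i f) = 0) {p : MvPolynomial (Fin (n + 1)) ℂ}
    (hp : p ∈ jacIdeal n f) : L p = 0 := by
  obtain ⟨c, rfl⟩ := Ideal.mem_span_range_iff_exists_fun.1 hp
  simp [h]

theorem MvPolynomial.IsHomogeneous.eq_C_eval {σ R : Type*} [CommSemiring R]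
    {p : MvPolynomial σ R} (hp : p.IsHomogeneous 0) : p = C (eval 0 p) := by
  have h := totalDegree_eq_zero_iff_eq_C.1 (Nat.le_zero.1 hp.totalDegree_le)
  rw [h]; simp

/-- The Cayley cubic. -/
noncomputable def cayleyCubic : MvPolynomial (Fin 4) ℂ :=
  X 0 * X 1 * X 2 + X 0 * X 1 * X 3 + X 0 * X 2 * X 3 + X 1 * X 2 * X 3

theorem pderiv_zero_cayleyCubic :
    pderiv 0 cayleyCubic = X 1 * X 2 + X 1 * X 3 + X 2 * X 3 := by
  simp [cayleyCubic, pderiv_X]; ring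

theorem pderiv_one_cayleyCubic :
    pderiv 1 cayleyCubic = X 0 * X 2 + X 0 * X 3 + X 2 * X 3 := by
  simp [cayleyCubic, pderiv_X]; ring

theorem pderiv_two_cayleyCubic :
    pderiv 2 cayleyCubic = X 0 * X 1 + X 0 * X 3 + X 1 * X 3 := by
  simp [cayleyCubic, pderiv_X]; ring

theorem pderiv_three_cayleyCubic :
    pderiv 3 cayleyCubic = X 0 * X 1 + X 0 * X 2 + X 1 * X 2 := by
  simp [cayleyCubic, pderiv_X]

theorem pderiv_mem_jacIdeal {n : ℕ} (f : MvPolynomial (Fin (n + 1)) ℂ) (i : Fin (n + 1)) :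
    pderiv i f ∈ jacIdeal n f :=
  Ideal.subset_span ⟨i, rfl⟩

theorem combination_mem_jacIdeal_cayleyCubic (a b c d : MvPolynomial (Fin 4) ℂ) :
    a * (X 1 * X 2 + X 1 * X 3 + X 2 * X 3) + b * (X 0 * X 2 + X 0 * X 3 + X 2 * X 3) +
      c * (X 0 * X 1 + X 0 * X 3 + X 1 * X 3) + d * (X 0 * X 1 + X 0 * X 2 + X 1 * X 2) ∈
      jacIdeal 3 cayleyCubic := by
  rw [← pderiv_zero_cayleyCubic, ← pderiv_one_cayleyCubic, ← pderiv_two_cayleyCubic,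
    ← pderiv_three_cayleyCubic]
  exact add_mem (add_mem (add_mem (Ideal.mul_mem_left _ _ (pderiv_mem_jacIdeal _ _))
    (Ideal.mul_mem_left _ _ (pderiv_mem_jacIdeal _ _)))
    (Ideal.mul_mem_left _ _ (pderiv_mem_jacIdeal _ _)))
    (Ideal.mul_mem_left _ _ (pderiv_mem_jacIdeal _ _))

theorem milnorDim_cayleyCubic_zero : milnorDim 3 cayleyCubic 0 = 1 := by
  rw [← finrank_self ℂ]
  refine milnorDim_eq_finrank (aeval (0 : Fin 4 → ℂ)).toLinearMap
    (fun p hp => ⟨fun h => ?_, fun h => ?_⟩)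
    fun u => ⟨C u, isHomogeneous_C _ _, by simp⟩
  · refine map_eq_zero_of_mem_jacIdeal _ (fun a i => ?_) h
    fin_cases i <;> simp [pderiv_zero_cayleyCubic, pderiv_one_cayleyCubic, pderiv_two_cayleyCubic,
      pderiv_three_cayleyCubic]
  · have h' : eval 0 p = 0 := by simpa [aeval_eq_eval] using h
    rw [hp.eq_C_eval, h']
    simp

theorem milnorDim_cayleyCubic_one : milnorDim 3 cayleyCubic 1 = 4 := by
  have h4 : finrank ℂ (Fin 4 → ℂ) = 4 := by simp
  rw [← h4]
  refine milnorDim_eq_finrank (LinearMap.pi fun i =>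
    (aeval (0 : Fin 4 → ℂ)).toLinearMap ∘ₗ (pderiv i).toLinearMap)
    (fun p hp => ⟨fun h => ?_, fun h => ?_⟩)
    fun u => ⟨∑ i, C (u i) * X i, IsHomogeneous.sum _ _ _ fun i _ => isHomogeneous_C_mul_X _ _, ?_⟩
  · refine map_eq_zero_of_mem_jacIdeal _ (fun a i => ?_) h
    ext j
    fin_cases i <;> simp [pderiv_zero_cayleyCubic, pderiv_one_cayleyCubic, pderiv_two_cayleyCubic,
      pderiv_three_cayleyCubic]
  · have hd (i) : pderiv i p = 0 := by
      have h' : eval 0 (pderiv i p) = 0 := by simpa [aeval_eq_eval] using congrFun h i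
      rw [(hp.pderiv (i := i)).eq_C_eval, h', C_0]
    have hE := hp.sum_X_mul_pderiv
    simp only [hd, mul_zero, Finset.sum_const_zero, one_smul] at hE
    rw [← hE]
    exact zero_mem _
  · ext j
    simp [pderiv_X, Pi.single_apply, apply_ite constantCoeff]

/-- The value at the origin of a second partial derivative. -/
noncomputable def hessianAtZero (i j : Fin 4) : MvPolynomial (Fin 4) ℂ →ₗ[ℂ] ℂ :=
  (aeval (0 : Fin 4 → ℂ)).toLinearMap ∘ₗ (pderiv i).toLinearMap ∘ₗ (pderiv j).toLinearMap

theorem hessianAtZero_apply (i j : Fin 4) (p : MvPolynomial (Fin 4) ℂ) :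
    hessianAtZero i j p = eval 0 (pderiv i (pderiv j p)) := by
  simp [hessianAtZero, aeval_eq_eval]

theorem two_smul_eq_sum_hessianAtZero {p : MvPolynomial (Fin 4) ℂ} (hp : p.IsHomogeneous 2) :
    2 • p = ∑ j, X j * ∑ i, X i * C (hessianAtZero i j p) := by
  rw [← hp.sum_X_mul_pderiv]
  refine Finset.sum_congr rfl fun j _ => ?_
  have hj : (pderiv j p).IsHomogeneous 1 := hp.pderiv
  congr 1
  rw [← one_smul ℕ (pderiv j p), ← hj.sum_X_mul_pderiv]
  refine Finset.sum_congr rfl fun i _ => ?_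
  rw [hessianAtZero_apply, ← (hj.pderiv (i := i)).eq_C_eval]

theorem hessianAtZero_comm (i j : Fin 4) (p : MvPolynomial (Fin 4) ℂ) :
    hessianAtZero i j p = hessianAtZero j i p := by
  have h : ⁅pderiv (R := ℂ) i, pderiv (R := ℂ) j⁆ = 0 := by
    ext k
    have hX (a b : Fin 4) : pderiv a (pderiv b (X k : MvPolynomial (Fin 4) ℂ)) = 0 := by
      rw [pderiv_X, Pi.single_apply]
      split_ifs <;> simp
    simp only [Derivation.commutator_apply, hX, sub_self, Derivation.zero_apply]
  have hp := DFunLike.congr_fun h p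
  rw [Derivation.commutator_apply, Derivation.zero_apply, sub_eq_zero] at hp
  rw [hessianAtZero_apply, hessianAtZero_apply, hp]

/-- Six functionals cutting out the quadrics of the Jacobian ideal of the Cayley cubic. -/
noncomputable def quadricFunctionals : MvPolynomial (Fin 4) ℂ →ₗ[ℂ] Fin 6 → ℂ :=
  LinearMap.pi ![hessianAtZero 0 0, hessianAtZero 1 1, hessianAtZero 2 2, hessianAtZero 3 3,
    hessianAtZero 0 1 + hessianAtZero 2 3 - hessianAtZero 0 2 - hessianAtZero 1 3,
    hessianAtZero 0 1 + hessianAtZero 2 3 - hessianAtZero 0 3 - hessianAtZero 1 2]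

theorem milnorDim_cayleyCubic_two : milnorDim 3 cayleyCubic 2 = 6 := by
  have h6 : finrank ℂ (Fin 6 → ℂ) = 6 := by simp
  rw [← h6]
  refine milnorDim_eq_finrank quadricFunctionals (fun p hp => ⟨fun h => ?_, fun h => ?_⟩)
    fun u => ⟨C (u 0 / 2) * (X 0 * X 0) + C (u 1 / 2) * (X 1 * X 1) + C (u 2 / 2) * (X 2 * X 2) +
      C (u 3 / 2) * (X 3 * X 3) + C (- u 4) * (X 0 * X 2) + C (- u 5) * (X 0 * X 3), ?_, ?_⟩
  · refine map_eq_zero_of_mem_jacIdeal _ (fun a i => ?_) h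
    ext j
    fin_cases i <;> fin_cases j <;> simp [quadricFunctionals, hessianAtZero_apply,
      pderiv_zero_cayleyCubic, pderiv_one_cayleyCubic, pderiv_two_cayleyCubic,
      pderiv_three_cayleyCubic, pderiv_X]
  · have h0 : hessianAtZero 0 0 p = 0 := congrFun h 0
    have h1 : hessianAtZero 1 1 p = 0 := congrFun h 1
    have h2 : hessianAtZero 2 2 p = 0 := congrFun h 2
    have h3 : hessianAtZero 3 3 p = 0 := congrFun h 3
    have h4 : hessianAtZero 0 1 p + hessianAtZero 2 3 p - hessianAtZero 0 2 p -
      hessianAtZero 1 3 p = 0 := congrFun h 4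
    have h5 : hessianAtZero 0 1 p + hessianAtZero 2 3 p - hessianAtZero 0 3 p -
      hessianAtZero 1 2 p = 0 := congrFun h 5
    have hE := two_smul_eq_sum_hessianAtZero hp
    simp only [Fin.sum_univ_four, hessianAtZero_comm 1 0, hessianAtZero_comm 2 0,
      hessianAtZero_comm 3 0, hessianAtZero_comm 2 1, hessianAtZero_comm 3 1,
      hessianAtZero_comm 3 2, h0, h1, h2, h3, C_0] at hE
    have h13 : hessianAtZero 1 3 p = hessianAtZero 0 1 p + hessianAtZero 2 3 p -
      hessianAtZero 0 2 p := by linear_combination -h4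
    have h12 : hessianAtZero 1 2 p = hessianAtZero 0 1 p + hessianAtZero 2 3 p -
      hessianAtZero 0 3 p := by linear_combination -h5
    rw [h12, h13] at hE
    set a := hessianAtZero 0 1 p
    set b := hessianAtZero 0 2 p
    set c := hessianAtZero 0 3 p
    set d := hessianAtZero 2 3 p
    have hhalf : (C (1 / 2) : MvPolynomial (Fin 4) ℂ) * 2 = 1 := by
      rw [← map_ofNat C 2, ← C_mul]; norm_num
    have hm := combination_mem_jacIdeal_cayleyCubic (C (1 / 2) * C (a + d + d - b - c))
      (C (1 / 2) * C (b + c - a)) (C (1 / 2) * C (a + c - b)) (C (1 / 2) * C (a + b - c))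
    convert hm using 1
    simp only [C_add, C_sub, nsmul_eq_mul, Nat.cast_ofNat] at hE ⊢
    linear_combination (C (1 / 2)) * hE - p * hhalf
  · have hh (c : ℂ) (i j : Fin 4) : (C c * (X i * X j) : MvPolynomial (Fin 4) ℂ).IsHomogeneous 2 :=
      ((isHomogeneous_X ℂ i).mul (isHomogeneous_X ℂ j)).C_mul c
    exact (((((hh _ _ _).add (hh _ _ _)).add (hh _ _ _)).add (hh _ _ _)).add (hh _ _ _)).add
      (hh _ _ _)
  · ext j
    fin_cases j <;> simp [quadricFunctionals, hessianAtZero_apply, pderiv_X] <;> ring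

theorem triangle_mem_jacIdeal_cayleyCubic {i j l : Fin 4} (hij : i ≠ j) (hil : i ≠ l)
    (hjl : j ≠ l) : X i * X j + X i * X l + X j * X l ∈ jacIdeal 3 cayleyCubic := by
  have h0 := pderiv_mem_jacIdeal (n := 3) cayleyCubic 0
  have h1 := pderiv_mem_jacIdeal (n := 3) cayleyCubic 1
  have h2 := pderiv_mem_jacIdeal (n := 3) cayleyCubic 2
  have h3 := pderiv_mem_jacIdeal (n := 3) cayleyCubic 3
  rw [pderiv_zero_cayleyCubic] at h0
  rw [pderiv_one_cayleyCubic] at h1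
  rw [pderiv_two_cayleyCubic] at h2
  rw [pderiv_three_cayleyCubic] at h3
  fin_cases i <;> fin_cases j <;> try exact absurd rfl hij
  all_goals fin_cases l <;> dsimp <;> first
    | exact absurd rfl hil
    | exact absurd rfl hjl
    | (convert h0 using 1 <;> ring1)
    | (convert h1 using 1 <;> ring1)
    | (convert h2 using 1 <;> ring1)
    | (convert h3 using 1 <;> ring1)

theorem X_mul_X_mul_X_mem_jacIdeal_cayleyCubic_of_ne {i j l : Fin 4} (hij : i ≠ j)
    (hil : i ≠ l) (hjl : j ≠ l) : X i * X j * X l ∈ jacIdeal 3 cayleyCubic := by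
  obtain ⟨m, hmi, hmj, hml⟩ : ∃ m, m ≠ i ∧ m ≠ j ∧ m ≠ l := by decide +revert
  have hthird : (C (1 / 3) : MvPolynomial (Fin 4) ℂ) * 3 = 1 := by
    rw [← map_ofNat C 3, ← C_mul]; norm_num
  have h1 := Ideal.mul_mem_left _ (C (1 / 3) * X i)
    (triangle_mem_jacIdeal_cayleyCubic hjl hmj.symm hml.symm)
  have h2 := Ideal.mul_mem_left _ (C (1 / 3) * X j)
    (triangle_mem_jacIdeal_cayleyCubic hil hmi.symm hml.symm)
  have h3 := Ideal.mul_mem_left _ (C (1 / 3) * X l)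
    (triangle_mem_jacIdeal_cayleyCubic hij hmi.symm hmj.symm)
  have h4 := Ideal.mul_mem_left _ (C (1 / 3) * 2 * X m)
    (triangle_mem_jacIdeal_cayleyCubic hij hil hjl)
  convert sub_mem (add_mem (add_mem h1 h2) h3) h4 using 1
  linear_combination -(X i * X j * X l) * hthird

theorem X_mul_X_mul_X_mem_jacIdeal_cayleyCubic_self {i j : Fin 4} (hij : i ≠ j) :
    X i * X i * X j ∈ jacIdeal 3 cayleyCubic := by
  obtain ⟨l, m, hli, hlj, hmi, hmj, hml⟩ :
      ∃ l m, l ≠ i ∧ l ≠ j ∧ m ≠ i ∧ m ≠ j ∧ m ≠ l := by decide +revert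
  have hhalf : (C (1 / 2) : MvPolynomial (Fin 4) ℂ) * 2 = 1 := by
    rw [← map_ofNat C 2, ← C_mul]; norm_num
  have h {a b : Fin 4} (ha : i ≠ a) (hb : i ≠ b) (hab : a ≠ b) :
      C (1 / 2) * (X i * (X i * X a + X i * X b + X a * X b) - X i * X a * X b) ∈
        jacIdeal 3 cayleyCubic :=
    Ideal.mul_mem_left _ _ (sub_mem
      (Ideal.mul_mem_left _ _ (triangle_mem_jacIdeal_cayleyCubic ha hb hab))
      (X_mul_X_mul_X_mem_jacIdeal_cayleyCubic_of_ne ha hb hab))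
  convert sub_mem (add_mem (h hij hli.symm hlj.symm) (h hij hmi.symm hmj.symm))
    (h hli.symm hmi.symm hml.symm) using 1
  linear_combination -(X i * X i * X j) * hhalf

theorem X_mul_X_mul_X_mem_jacIdeal_cayleyCubic {i j : Fin 4} (hij : i ≠ j) (l : Fin 4) :
    X i * X j * X l ∈ jacIdeal 3 cayleyCubic := by
  rcases eq_or_ne i l with rfl | hil
  · rw [mul_right_comm]
    exact X_mul_X_mul_X_mem_jacIdeal_cayleyCubic_self hij
  rcases eq_or_ne j l with rfl | hjl
  · rw [mul_rotate]
    exact X_mul_X_mul_X_mem_jacIdeal_cayleyCubic_self hij.symm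
  exact X_mul_X_mul_X_mem_jacIdeal_cayleyCubic_of_ne hij hil hjl

theorem monomial_mem_jacIdeal_cayleyCubic {k : ℕ} (hk : 3 ≤ k) {m : Fin 4 →₀ ℕ}
    (hm : m.degree = k) (hne : ∀ i, m ≠ Finsupp.single i k) (c : ℂ) :
    monomial m c ∈ jacIdeal 3 cayleyCubic := by
  have key (m : Fin 4 →₀ ℕ) (h : m ≠ 0) : ∃ i m', m = Finsupp.single i 1 + m' := by
    obtain ⟨i, hi⟩ := Finsupp.ne_iff.1 h
    refine ⟨i, m - Finsupp.single i 1, (add_tsub_cancel_of_le ?_).symm⟩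
    exact Finsupp.single_le_iff.2 (Nat.one_le_iff_ne_zero.2 hi)
  obtain ⟨i, m₁, rfl⟩ := key m (by rintro rfl; simp at hm; omega)
  have hd : 1 + m₁.degree = k := by simpa using hm
  obtain ⟨j, hij, hj⟩ : ∃ j, i ≠ j ∧ m₁ j ≠ 0 := by
    by_contra! hcon
    have hm₁ : m₁ = Finsupp.single i (m₁ i) := by
      ext j
      rcases eq_or_ne i j with rfl | h
      · simp
      · simp [hcon j h, h]
    apply hne i
    rw [hm₁, Finsupp.degree_single] at hd
    rw [hm₁, ← Finsupp.single_add, hd]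
  obtain ⟨m₂, rfl⟩ : ∃ m₂, m₁ = Finsupp.single j 1 + m₂ :=
    ⟨_, (add_tsub_cancel_of_le (Finsupp.single_le_iff.2 (Nat.one_le_iff_ne_zero.2 hj))).symm⟩
  obtain ⟨l, m₃, rfl⟩ := key m₂ (by rintro rfl; simp at hd; omega)
  have h := Ideal.mul_mem_right (monomial m₃ c) _
    (X_mul_X_mul_X_mem_jacIdeal_cayleyCubic hij l)
  simpa [X, monomial_mul, add_assoc] using h

theorem MvPolynomial.IsHomogeneous.eval_single_one {σ R : Type*} [Fintype σ] [DecidableEq σ]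
    [CommSemiring R] {p : MvPolynomial σ R} {k : ℕ} (hp : p.IsHomogeneous k) (i : σ) :
    eval (Pi.single i 1) p = coeff (Finsupp.single i k) p := by
  rw [eval_eq', Finset.sum_eq_single (Finsupp.single i k)]
  · rw [Finset.prod_eq_one, mul_one]
    intro j _
    rcases eq_or_ne i j with rfl | h
    · simp
    · simp [h]
  · intro m hm hne
    obtain ⟨j, hij, hj⟩ : ∃ j, i ≠ j ∧ m j ≠ 0 := by
      by_contra! hcon
      have hm' : m = Finsupp.single i (m i) := by
        ext j
        rcases eq_or_ne i j with rfl | h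
        · simp
        · simp [hcon j h, h]
      have hd : m.degree = k := by
        by_contra hd
        exact mem_support_iff.1 hm (hp.coeff_eq_zero hd)
      rw [hm', Finsupp.degree_single] at hd
      exact hne (hd ▸ hm')
    rw [Finset.prod_eq_zero (Finset.mem_univ j), mul_zero]
    simp [hij.symm, hj]
  · intro h
    rw [notMem_support_iff.1 h, zero_mul]

theorem milnorDim_cayleyCubic_of_three_le {k : ℕ} (hk : 3 ≤ k) :
    milnorDim 3 cayleyCubic k = 4 := by
  have h4 : finrank ℂ (Fin 4 → ℂ) = 4 := by simp
  rw [← h4]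
  refine milnorDim_eq_finrank (LinearMap.pi fun i =>
    (aeval (Pi.single i 1 : Fin 4 → ℂ)).toLinearMap) (fun p hp => ⟨fun h => ?_, fun h => ?_⟩)
    fun u => ⟨∑ i, C (u i) * X i ^ k, IsHomogeneous.sum _ _ _ fun i _ =>
      (isHomogeneous_X_pow i k).C_mul _, ?_⟩
  · refine map_eq_zero_of_mem_jacIdeal _ (fun a i => ?_) h
    ext j
    fin_cases i <;> fin_cases j <;> simp [pderiv_zero_cayleyCubic, pderiv_one_cayleyCubic,
      pderiv_two_cayleyCubic, pderiv_three_cayleyCubic]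
  · rw [p.as_sum]
    refine sum_mem fun m hm => monomial_mem_jacIdeal_cayleyCubic hk ?_ ?_ _
    · by_contra hd
      exact mem_support_iff.1 hm (hp.coeff_eq_zero hd)
    · rintro i rfl
      rw [MvPolynomial.mem_support_iff, ← hp.eval_single_one] at hm
      exact hm (by simpa [aeval_eq_eval] using congrFun h i)
  · ext j
    have : k ≠ 0 := by omega
    simp [Pi.single_apply, ite_pow, this]

/-- The Hilbert function of the Milnor algebra of the Cayley cubic
`f = xyz + xyw + xzw + yzw`: `1, 4, 6, 4, 4, 4, …`. -/
theorem milnor_hilbert_cayley_cubic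
    (f : MvPolynomial (Fin 4) ℂ)
    (hf : f = X 0 * X 1 * X 2 + X 0 * X 1 * X 3 + X 0 * X 2 * X 3 + X 1 * X 2 * X 3) :
    milnorDim 3 f 0 = 1 ∧ milnorDim 3 f 1 = 4 ∧ milnorDim 3 f 2 = 6 ∧
      milnorDim 3 f 3 = 4 ∧ ∀ k : ℕ, 4 ≤ k → milnorDim 3 f k = 4 := by
  obtain rfl : f = cayleyCubic := hf
  exact ⟨milnorDim_cayleyCubic_zero, milnorDim_cayleyCubic_one, milnorDim_cayleyCubic_two,
    milnorDim_cayleyCubic_of_three_le le_rfl,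
    fun k hk => milnorDim_cayleyCubic_of_three_le (by omega)⟩
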